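/- Let q not be a root of unity and let (I1,I2,I3) be a classical irreducible representation of AW_q(A1,A2,A3) on a complex vector space V of dimension N+1, and let μ ∈ ℂ be such that the eigenvalues of I3 are −i·[μ]_q, …, −i·[μ−N]_q and O_μ annihilates an eigenvector for −i·[μ]_q. Define D̃_j := C̃_μ − C̃_{μ−j} and Λ_j := [μ−j+1]_q + [μ−j]_q. Then D̃_{N+1} = 0, Λ_{N+1} ≠ Λ_0, and D̃_k ≠ 0 for every k ∈ {1, …, N}. -/

import Mathlib

noncomputable section

/-- `q^λ := exp (λ·L)`, where `L` is a fixed logarithm of `q` (so `q = exp L` and the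
fixed square root is `q^{1/2} = exp (L/2) = qp L (1/2)`). -/
def qp (L lam : ℂ) : ℂ := Complex.exp (lam * L)

/-- The `q`-number `[λ]_q = (q^λ − q^{−λ})/(q − q⁻¹)`. -/
def qn (L lam : ℂ) : ℂ :=
  (qp L lam - qp L (-lam)) / (Complex.exp L - (Complex.exp L)⁻¹)

variable {V : Type*} [AddCommGroup V] [Module ℂ V]

/-- A representation of `AW_q(A1,A2,A3)` on `V`: a triple of endomorphisms satisfying the
Askey–Wilson `q`-commutation relations. -/
def IsAWRep (L A1 A2 A3 : ℂ) (I1 I2 I3 : Module.End ℂ V) : Prop :=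
  qp L (1/2) • (I1 * I2) - qp L (-(1/2)) • (I2 * I1) = I3 + A3 • (1 : Module.End ℂ V) ∧
  qp L (1/2) • (I2 * I3) - qp L (-(1/2)) • (I3 * I2) = I1 + A1 • (1 : Module.End ℂ V) ∧
  qp L (1/2) • (I3 * I1) - qp L (-(1/2)) • (I1 * I3) = I2 + A2 • (1 : Module.End ℂ V)

/-- Irreducibility: the only subspaces invariant under `I1, I2, I3` are `⊥` and `⊤`. -/
def IsIrreducibleRep (I1 I2 I3 : Module.End ℂ V) : Prop :=
  ∀ W : Submodule ℂ V,
    Submodule.map I1 W ≤ W → Submodule.map I2 W ≤ W → Submodule.map I3 W ≤ W →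
      W = ⊥ ∨ W = ⊤

/-- Classical: none of `±2/(q−q⁻¹)`, `±1/(q^{1/2}−q^{−1/2})` is an eigenvalue of `I3`. -/
def IsClassicalRep (L : ℂ) (I3 : Module.End ℂ V) : Prop :=
  ∀ ε : ℂ, ε = 1 ∨ ε = -1 →
    ¬ Module.End.HasEigenvalue I3 (2 * ε / (Complex.exp L - (Complex.exp L)⁻¹)) ∧
    ¬ Module.End.HasEigenvalue I3 (ε / (qp L (1/2) - qp L (-(1/2))))

/-- The raising shift operator `O_λ`.  (When `A1 = A2 = 0` the coefficient of `I3`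
vanishes, giving `O_λ = i·I2 + q^{−λ+1/2}·I1` for every `λ`.) -/
def Oop (L A1 A2 lam : ℂ) (I1 I2 I3 : Module.End ℂ V) : Module.End ℂ V :=
  ((-Complex.I * qp L (1/2) * A1 + qp L (-lam) * A2) /
      (qn L lam * (qn L lam - qn L (lam + 1)))) • I3
    + Complex.I • I2 + qp L (-lam + 1/2) • I1

/-- The lowering shift operator `R_λ`.  (When `A1 = A2 = 0` the coefficient of `I3`
vanishes, giving `R_λ = i·I2 − q^{λ+1/2}·I1` for every `λ`.) -/
def Rop (L A1 A2 lam : ℂ) (I1 I2 I3 : Module.End ℂ V) : Module.End ℂ V :=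
  ((-Complex.I * qp L (1/2) * A1 - qp L lam * A2) /
      (qn L lam * (qn L lam - qn L (lam - 1)))) • I3
    + Complex.I • I2 - qp L (lam + 1/2) • I1

/-- The scalar `C̃_λ`. -/
def Ctilde (L A1 A2 A3 lam : ℂ) : ℂ :=
  -(Complex.exp L) * qn L lam * qn L (lam + 1)
    - Complex.I * Complex.exp L * (qn L lam + qn L (lam + 1)) * A3
    - Complex.exp L *
        (A1 ^ 2 + Complex.I * (qp L (-lam - 1/2) - qp L (lam + 1/2)) * A1 * A2 + A2 ^ 2) /
      (qn L lam - qn L (lam + 1)) ^ 2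

/-- `D̃_j := C̃_μ − C̃_{μ−j}`. -/
def Dtilde (L A1 A2 A3 μ j : ℂ) : ℂ :=
  Ctilde L A1 A2 A3 μ - Ctilde L A1 A2 A3 (μ - j)

/-- `Λ_j := [μ−j+1]_q + [μ−j]_q`. -/
def LamF (L μ j : ℂ) : ℂ := qn L (μ - j + 1) + qn L (μ - j)

/-- The `q`-number `[λ]_q` in terms of `x = q^λ` and `s = q^{1/2}`. -/
def awNum (s x : ℂ) : ℂ := (x - x⁻¹) / (s ^ 2 - (s ^ 2)⁻¹)

open Complex in
/-- The eigenvalue `−i·[λ]_q` of `I3` in terms of `x = q^λ` and `s = q^{1/2}`. -/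
def awEig (s x : ℂ) : ℂ := -I * awNum s x

open Complex in
/-- The scalar by which the `I3`-term of `O_λ` acts on an `I3`-eigenvector, with `x = q^λ`. -/
def awShiftConst (s A1 A2 x : ℂ) : ℂ := (s ^ 2 + 1) * (s * x * A1 + I * A2) / (s ^ 2 * x ^ 2 + 1)

open Complex in
/-- The raising operator on the `I3`-eigenspace for `x = q^λ`; replacing `x` by `-x⁻¹` gives the
lowering operator. -/
def awShift (s A1 A2 x : ℂ) (I1 I2 : Module.End ℂ V) : Module.End ℂ V :=
  awShiftConst s A1 A2 x • (1 : Module.End ℂ V) + I • I2 + (s * x⁻¹) • I1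

/-- The Casimir element. -/
def awCasimir (s A1 A2 A3 : ℂ) (I1 I2 I3 : Module.End ℂ V) : Module.End ℂ V :=
  s ^ 4 • (I1 * I1) + I2 * I2 + s ^ 4 • (I3 * I3) - (s ^ 5 - s) • (I1 * I2 * I3) +
    (s ^ 2 * (s ^ 2 + 1) * A1) • I1 + ((s ^ 2 + 1) * A2) • I2 + (s ^ 2 * (s ^ 2 + 1) * A3) • I3

open Complex in
/-- The scalar `C̃_λ` in terms of `x = q^λ` and `s = q^{1/2}`. -/
def awCtilde (s A1 A2 A3 x : ℂ) : ℂ :=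
  -(s ^ 2) * awNum s x * awNum s (s ^ 2 * x) -
    I * s ^ 2 * (awNum s x + awNum s (s ^ 2 * x)) * A3 -
    s ^ 2 * (A1 ^ 2 + I * (s⁻¹ * x⁻¹ - s * x) * A1 * A2 + A2 ^ 2) /
      (awNum s x - awNum s (s ^ 2 * x)) ^ 2

theorem sq_sub_inv_sq_ne_zero {s : ℂ} (hs : s ≠ 0) (hs4 : s ^ 4 - 1 ≠ 0) :
    s ^ 2 - (s ^ 2)⁻¹ ≠ 0 := by
  intro hd
  apply hs4
  field_simp at hd
  linear_combination hd

theorem awNum_neg_inv (s x : ℂ) : awNum s (-x⁻¹) = awNum s x := by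
  rw [awNum, awNum, inv_neg, inv_inv]
  ring

theorem awEig_neg_inv (s x : ℂ) : awEig s (-x⁻¹) = awEig s x := by
  rw [awEig, awEig, awNum_neg_inv]

theorem mul_neg_inv_eq (s x : ℂ) : s ^ 2 * -x⁻¹ = -(x / s ^ 2)⁻¹ := by
  rw [inv_div]
  ring

theorem awCtilde_neg_inv {s x : ℂ} (hs : s ≠ 0) (hx : x ≠ 0) (A1 A2 A3 : ℂ) :
    awCtilde s A1 A2 A3 (-x⁻¹) = awCtilde s A1 A2 A3 (x / s ^ 2) := by
  have h1 : s ^ 2 * (x / s ^ 2) = x := by field_simp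
  have h2 : s⁻¹ * (-x⁻¹)⁻¹ - s * -x⁻¹ = s⁻¹ * (x / s ^ 2)⁻¹ - s * (x / s ^ 2) := by
    field_simp
    ring
  rw [awCtilde, awCtilde, h1, h2, mul_neg_inv_eq, awNum_neg_inv, awNum_neg_inv,
    sub_sq_comm (awNum s x)]
  ring

theorem eq_or_mul_eq_neg_one_of_awEig_eq {s x y : ℂ} (hs : s ≠ 0) (hs4 : s ^ 4 - 1 ≠ 0)
    (hx : x ≠ 0) (hy : y ≠ 0) (h : awEig s x = awEig s y) : x = y ∨ x * y = -1 := by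
  have hd := sq_sub_inv_sq_ne_zero hs hs4
  have h1 : x - x⁻¹ = y - y⁻¹ := by
    have h2 := mul_left_cancel₀ (neg_ne_zero.2 Complex.I_ne_zero) h
    rwa [awNum, awNum, div_left_inj' hd] at h2
  have h2 : (x - y) * (x * y + 1) = 0 := by
    field_simp at h1
    linear_combination h1
  rcases mul_eq_zero.1 h2 with h3 | h3
  · exact Or.inl (sub_eq_zero.1 h3)
  · exact Or.inr (eq_neg_of_add_eq_zero_left h3)

/-- The Askey–Wilson relations, in terms of `s = q^{1/2}`. -/
def IsAWTriple (s A1 A2 A3 : ℂ) (I1 I2 I3 : Module.End ℂ V) : Prop :=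
  s • (I1 * I2) - s⁻¹ • (I2 * I1) = I3 + A3 • (1 : Module.End ℂ V) ∧
  s • (I2 * I3) - s⁻¹ • (I3 * I2) = I1 + A1 • (1 : Module.End ℂ V) ∧
  s • (I3 * I1) - s⁻¹ • (I1 * I3) = I2 + A2 • (1 : Module.End ℂ V)

namespace IsAWTriple

variable {s A1 A2 A3 : ℂ} {I1 I2 I3 : Module.End ℂ V}

theorem apply_one_two (h : IsAWTriple s A1 A2 A3 I1 I2 I3) (hs : s ≠ 0) (v : V) :
    I1 (I2 v) = s⁻¹ • I3 v + (s⁻¹ * A3) • v + (s⁻¹ ^ 2) • I2 (I1 v) := by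
  have h1 := LinearMap.congr_fun h.1 v
  simp only [LinearMap.sub_apply, LinearMap.smul_apply, Module.End.mul_apply, LinearMap.add_apply,
    Module.End.one_apply] at h1
  linear_combination (norm := skip) s⁻¹ • h1
  match_scalars <;> field_simp <;> ring

theorem apply_two_three (h : IsAWTriple s A1 A2 A3 I1 I2 I3) (hs : s ≠ 0) (v : V) :
    I2 (I3 v) = s⁻¹ • I1 v + (s⁻¹ * A1) • v + (s⁻¹ ^ 2) • I3 (I2 v) := by
  have h1 := LinearMap.congr_fun h.2.1 v
  simp only [LinearMap.sub_apply, LinearMap.smul_apply, Module.End.mul_apply, LinearMap.add_apply,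
    Module.End.one_apply] at h1
  linear_combination (norm := skip) s⁻¹ • h1
  match_scalars <;> field_simp <;> ring

theorem apply_one_three (h : IsAWTriple s A1 A2 A3 I1 I2 I3) (hs : s ≠ 0) (v : V) :
    I1 (I3 v) = (s ^ 2) • I3 (I1 v) - s • I2 v - (s * A2) • v := by
  have h1 := LinearMap.congr_fun h.2.2 v
  simp only [LinearMap.sub_apply, LinearMap.smul_apply, Module.End.mul_apply, LinearMap.add_apply,
    Module.End.one_apply] at h1
  linear_combination (norm := skip) -s • h1
  match_scalars <;> field_simp <;> ring

theorem casimir_three (h : IsAWTriple s A1 A2 A3 I1 I2 I3) (hs : s ≠ 0) (v : V) :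
    awCasimir s A1 A2 A3 I1 I2 I3 (I3 v) = I3 (awCasimir s A1 A2 A3 I1 I2 I3 v) := by
  simp only [awCasimir, LinearMap.sub_apply, LinearMap.smul_apply, Module.End.mul_apply,
    LinearMap.add_apply, map_add, map_sub, map_smul, smul_add, smul_sub, smul_smul,
    h.apply_one_two hs, h.apply_two_three hs, h.apply_one_three hs]
  match_scalars <;> field_simp <;> ring

theorem casimir_one (h : IsAWTriple s A1 A2 A3 I1 I2 I3) (hs : s ≠ 0) (v : V) :
    awCasimir s A1 A2 A3 I1 I2 I3 (I1 v) = I1 (awCasimir s A1 A2 A3 I1 I2 I3 v) := by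
  simp only [awCasimir, LinearMap.sub_apply, LinearMap.smul_apply, Module.End.mul_apply,
    LinearMap.add_apply, map_add, map_sub, map_smul, smul_add, smul_sub, smul_smul,
    h.apply_one_two hs, h.apply_two_three hs, h.apply_one_three hs]
  match_scalars <;> field_simp <;> ring

theorem apply_two (h : IsAWTriple s A1 A2 A3 I1 I2 I3) (v : V) :
    I2 v = s • I3 (I1 v) - s⁻¹ • I1 (I3 v) - A2 • v := by
  have h1 := LinearMap.congr_fun h.2.2 v
  simp only [LinearMap.sub_apply, LinearMap.smul_apply, Module.End.mul_apply, LinearMap.add_apply,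
    Module.End.one_apply] at h1
  linear_combination (norm := module) -h1

theorem casimir_two (h : IsAWTriple s A1 A2 A3 I1 I2 I3) (hs : s ≠ 0) (v : V) :
    awCasimir s A1 A2 A3 I1 I2 I3 (I2 v) = I2 (awCasimir s A1 A2 A3 I1 I2 I3 v) := by
  rw [h.apply_two, h.apply_two (awCasimir s A1 A2 A3 I1 I2 I3 v)]
  simp only [map_sub, map_smul, h.casimir_one hs, h.casimir_three hs]

/-- On an irreducible finite-dimensional representation the Casimir element is a scalar. -/
theorem exists_casimir_eq_smul [FiniteDimensional ℂ V] [Nontrivial V]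
    (h : IsAWTriple s A1 A2 A3 I1 I2 I3) (hs : s ≠ 0) (hirr : IsIrreducibleRep I1 I2 I3) :
    ∃ κ : ℂ, ∀ v, awCasimir s A1 A2 A3 I1 I2 I3 v = κ • v := by
  obtain ⟨κ, hκ⟩ := Module.End.exists_eigenvalue (awCasimir s A1 A2 A3 I1 I2 I3)
  refine ⟨κ, fun v => ?_⟩
  have key : ∀ T : Module.End ℂ V, (∀ v, awCasimir s A1 A2 A3 I1 I2 I3 (T v) =
      T (awCasimir s A1 A2 A3 I1 I2 I3 v)) →
      Submodule.map T (Module.End.eigenspace (awCasimir s A1 A2 A3 I1 I2 I3) κ) ≤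
        Module.End.eigenspace (awCasimir s A1 A2 A3 I1 I2 I3) κ := by
    rintro T hT _ ⟨w, hw, rfl⟩
    rw [SetLike.mem_coe, Module.End.mem_eigenspace_iff] at hw
    rw [Module.End.mem_eigenspace_iff, hT, hw, map_smul]
  rcases hirr _ (key I1 (h.casimir_one hs)) (key I2 (h.casimir_two hs))
    (key I3 (h.casimir_three hs)) with h0 | h1
  · exact absurd h0 hκ
  · rw [← Module.End.mem_eigenspace_iff, h1]
    trivial

theorem three_shift (h : IsAWTriple s A1 A2 A3 I1 I2 I3) (hs : s ≠ 0)
    (hs4 : s ^ 4 - 1 ≠ 0) {x : ℂ} (hx : x ≠ 0) (hqx : s ^ 2 * x ^ 2 + 1 ≠ 0) {v : V}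
    (hv : I3 v = awEig s x • v) :
    I3 (awShift s A1 A2 x I1 I2 v) = awEig s (s ^ 2 * x) • awShift s A1 A2 x I1 I2 v := by
  have h1 := h.apply_one_three hs v
  have h2 := h.apply_two_three hs v
  have hI := Complex.I_sq
  simp only [hv, map_smul] at h1 h2
  have h3 : I3 (I2 v) = (s ^ 2 * awEig s x) • I2 v - s • I1 v - (s * A1) • v := by
    linear_combination (norm := skip) (-s ^ 2) • h2
    match_scalars <;> field_simp <;> ring
  have h4 : I3 (I1 v) = (s⁻¹ ^ 2 * awEig s x) • I1 v + s⁻¹ • I2 v + (s⁻¹ * A2) • v := by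
    linear_combination (norm := skip) (-s⁻¹ ^ 2) • h1
    match_scalars <;> field_simp <;> ring
  simp only [awShift, LinearMap.smul_apply, LinearMap.add_apply, map_add, map_smul,
    Module.End.one_apply, h3, h4, hv]
  have hd := sq_sub_inv_sq_ne_zero hs hs4
  simp only [awEig, awNum, awShiftConst]
  match_scalars <;> field_simp <;> ring_nf <;> simp only [hI] <;> ring

theorem lower_raise (h : IsAWTriple s A1 A2 A3 I1 I2 I3) (hs : s ≠ 0)
    (hs4 : s ^ 4 - 1 ≠ 0) {x : ℂ} (hx : x ≠ 0) (hqx : s ^ 2 * x ^ 2 + 1 ≠ 0) {v : V}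
    (hv : I3 v = awEig s x • v) {κ : ℂ} (hκ : awCasimir s A1 A2 A3 I1 I2 I3 v = κ • v) :
    awShift s A1 A2 (-(s ^ 2 * x)⁻¹) I1 I2 (awShift s A1 A2 x I1 I2 v) =
      (awCtilde s A1 A2 A3 x - κ) • v := by
  have h12 := h.apply_one_two hs v
  have hI := Complex.I_sq
  have hd := sq_sub_inv_sq_ne_zero hs hs4
  have hn : awNum s x - awNum s (s ^ 2 * x) =
      -((s ^ 2 * x ^ 2 + 1) / (x * (s ^ 2 + 1))) := by
    have h1 : s ^ 2 + 1 ≠ 0 := fun h0 => hs4 (by linear_combination (s ^ 2 - 1) * h0)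
    simp only [awNum]
    field_simp
    ring
  have hc : awShiftConst s A1 A2 (-(s ^ 2 * x)⁻¹) =
      (s ^ 2 + 1) * (-s * x * A1 + Complex.I * s ^ 2 * x ^ 2 * A2) / (s ^ 2 * x ^ 2 + 1) := by
    have h1 : s ^ 2 * (-(s ^ 2 * x)⁻¹) ^ 2 + 1 ≠ 0 := by
      intro h0
      apply hqx
      field_simp at h0
      linear_combination h0
    rw [awShiftConst, div_eq_div_iff h1 hqx]
    field_simp
    ring
  simp only [awCasimir, LinearMap.sub_apply, LinearMap.smul_apply, Module.End.mul_apply,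
    LinearMap.add_apply, hv, map_smul] at hκ h12
  simp only [awShift, awCtilde, hn, hc, LinearMap.smul_apply, LinearMap.add_apply, map_add,
    map_smul, Module.End.one_apply]
  linear_combination (norm := skip) -hκ - (Complex.I * s ^ 3 * x⁻¹) • h12
  simp only [awEig, awNum, awShiftConst]
  match_scalars <;> field_simp <;> ring_nf <;> simp only [hI] <;> ring

theorem three_lower (h : IsAWTriple s A1 A2 A3 I1 I2 I3) (hs : s ≠ 0)
    (hs4 : s ^ 4 - 1 ≠ 0) {x : ℂ} (hx : x ≠ 0) (hqx : x ^ 2 + s ^ 2 ≠ 0) {v : V}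
    (hv : I3 v = awEig s x • v) :
    I3 (awShift s A1 A2 (-x⁻¹) I1 I2 v) =
      awEig s (x / s ^ 2) • awShift s A1 A2 (-x⁻¹) I1 I2 v := by
  rw [← awEig_neg_inv] at hv
  rw [← awEig_neg_inv s (x / s ^ 2), ← mul_neg_inv_eq]
  refine h.three_shift hs hs4 (neg_ne_zero.2 (inv_ne_zero hx)) ?_ hv
  intro h0
  apply hqx
  field_simp at h0
  linear_combination h0

theorem raise_lower (h : IsAWTriple s A1 A2 A3 I1 I2 I3) (hs : s ≠ 0)
    (hs4 : s ^ 4 - 1 ≠ 0) {x : ℂ} (hx : x ≠ 0) (hqx : x ^ 2 + s ^ 2 ≠ 0) {v : V}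
    (hv : I3 v = awEig s x • v) {κ : ℂ} (hκ : awCasimir s A1 A2 A3 I1 I2 I3 v = κ • v) :
    awShift s A1 A2 (x / s ^ 2) I1 I2 (awShift s A1 A2 (-x⁻¹) I1 I2 v) =
      (awCtilde s A1 A2 A3 (x / s ^ 2) - κ) • v := by
  have h1 : -(s ^ 2 * -x⁻¹)⁻¹ = x / s ^ 2 := by
    rw [mul_neg_inv_eq, inv_neg, inv_inv, neg_neg]
  rw [← awCtilde_neg_inv hs hx]
  nth_rewrite 1 [← h1]
  rw [← awEig_neg_inv] at hv
  refine h.lower_raise hs hs4 (neg_ne_zero.2 (inv_ne_zero hx)) ?_ hv hκ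
  intro h0
  apply hqx
  field_simp at h0
  linear_combination h0

end IsAWTriple

/-- A subspace containing `v` and both of its shifts contains `I1 v` and `I2 v`. -/
theorem mem_of_awShift_mem {s A1 A2 x : ℂ} {I1 I2 : Module.End ℂ V} (hs : s ≠ 0) (hx : x ≠ 0)
    (hx2 : x ^ 2 + 1 ≠ 0) {W : Submodule ℂ V} {v : V} (hv : v ∈ W)
    (h1 : awShift s A1 A2 x I1 I2 v ∈ W) (h2 : awShift s A1 A2 (-x⁻¹) I1 I2 v ∈ W) :
    I1 v ∈ W ∧ I2 v ∈ W := by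
  have hI := Complex.I_sq
  have h3 : I1 v ∈ W := by
    have h4 : I1 v = (x / (s * (x ^ 2 + 1))) • (awShift s A1 A2 x I1 I2 v -
        awShift s A1 A2 (-x⁻¹) I1 I2 v -
        (awShiftConst s A1 A2 x - awShiftConst s A1 A2 (-x⁻¹)) • v) := by
      simp only [awShift, LinearMap.smul_apply, LinearMap.add_apply, Module.End.one_apply]
      match_scalars <;> field_simp <;> ring
    rw [h4]
    exact W.smul_mem _ (W.sub_mem (W.sub_mem h1 h2) (W.smul_mem _ hv))
  refine ⟨h3, ?_⟩
  have h4 : I2 v = (-Complex.I) • (awShift s A1 A2 x I1 I2 v - (s * x⁻¹) • I1 v -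
      awShiftConst s A1 A2 x • v) := by
    simp only [awShift, LinearMap.smul_apply, LinearMap.add_apply, Module.End.one_apply]
    match_scalars <;> ring_nf <;> simp [hI]
  rw [h4]
  exact W.smul_mem _ (W.sub_mem (W.sub_mem h1 (W.smul_mem _ h3)) (W.smul_mem _ hv))

/-- The span of a proper nonempty set of `I3`-eigenvectors from an independent family cannot be
stable under the shifts in an irreducible representation. -/
theorem eq_univ_of_awShift_mem {ι : Type*} {s A1 A2 : ℂ} {I1 I2 I3 : Module.End ℂ V} (hs : s ≠ 0)
    (hirr : IsIrreducibleRep I1 I2 I3) {x : ι → ℂ} {v : ι → V} (hv : LinearIndependent ℂ v)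
    (hx : ∀ j, x j ≠ 0) (hx2 : ∀ j, x j ^ 2 + 1 ≠ 0) (hI3 : ∀ j, I3 (v j) = awEig s (x j) • v j)
    {J : Set ι} (hJ : J.Nonempty)
    (h1 : ∀ j ∈ J, awShift s A1 A2 (x j) I1 I2 (v j) ∈ Submodule.span ℂ (v '' J))
    (h2 : ∀ j ∈ J, awShift s A1 A2 (-(x j)⁻¹) I1 I2 (v j) ∈ Submodule.span ℂ (v '' J)) :
    J = Set.univ := by
  have hmem : ∀ j ∈ J, v j ∈ Submodule.span ℂ (v '' J) := fun j hj =>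
    Submodule.subset_span (Set.mem_image_of_mem v hj)
  have h12 := fun j hj => mem_of_awShift_mem hs (hx j) (hx2 j) (hmem j hj) (h1 j hj) (h2 j hj)
  rcases hirr (Submodule.span ℂ (v '' J))
    ((Submodule.map_span_le _ _ _).2 (Set.forall_mem_image.2 fun j hj => (h12 j hj).1))
    ((Submodule.map_span_le _ _ _).2 (Set.forall_mem_image.2 fun j hj => (h12 j hj).2))
    ((Submodule.map_span_le _ _ _).2 (Set.forall_mem_image.2 fun j hj => by
      rw [hI3]
      exact Submodule.smul_mem _ _ (hmem j hj))) with h0 | h0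
  · obtain ⟨j, hj⟩ := hJ
    have h3 := hmem j hj
    rw [h0, Submodule.mem_bot] at h3
    exact absurd h3 (hv.ne_zero j)
  · refine Set.eq_univ_of_forall fun j => ?_
    by_contra hj
    exact hv.notMem_span_image hj (h0 ▸ Submodule.mem_top)

/-- If `I3` has a diagonalizing family of eigenvectors with distinct eigenvalues, its
eigenvectors are multiples of the members of the family. -/
theorem exists_eq_smul_of_apply_eq_smul {ι : Type*} [Fintype ι] {T : Module.End ℂ V} {e : ι → ℂ}
    (he : Function.Injective e) {v : ι → V} (hv : LinearIndependent ℂ v)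
    (hspan : ⊤ ≤ Submodule.span ℂ (Set.range v)) (hT : ∀ j, T (v j) = e j • v j) {i : ι} {w : V}
    (hw : T w = e i • w) : ∃ c : ℂ, w = c • v i := by
  classical
  obtain ⟨c, rfl⟩ := (Submodule.mem_span_range_iff_exists_fun ℂ).1
    (hspan (Submodule.mem_top (x := w)))
  have h1 : ∑ j, (c j * (e j - e i)) • v j = 0 := by
    rw [map_sum, Finset.smul_sum, ← sub_eq_zero, ← Finset.sum_sub_distrib] at hw
    rw [← hw]
    refine Finset.sum_congr rfl fun j _ => ?_
    rw [map_smul, hT]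
    module
  refine ⟨c i, Finset.sum_eq_single i (fun j _ hj => ?_) (by simp)⟩
  have h2 := Fintype.linearIndependent_iff.1 hv _ h1 j
  rw [(mul_eq_zero.1 h2).resolve_right (sub_ne_zero.2 (he.ne hj)), zero_smul]

theorem eq_or_mul_eq_neg_one_of_awNum_add_eq {s x y : ℂ} (hs : s ≠ 0) (hs4 : s ^ 4 - 1 ≠ 0)
    (hx : x ≠ 0) (hy : y ≠ 0)
    (h : awNum s (s ^ 2 * x) + awNum s x = awNum s (s ^ 2 * y) + awNum s y) :
    x = y ∨ s ^ 2 * (x * y) = -1 := by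
  have hd := sq_sub_inv_sq_ne_zero hs hs4
  have hs2 : s ^ 2 + 1 ≠ 0 := fun h0 => hs4 (by linear_combination (s ^ 2 - 1) * h0)
  have h1 : (s ^ 2 + 1) * ((x - y) * (s ^ 2 * (x * y) + 1)) = 0 := by
    simp only [awNum, ← add_div] at h
    rw [div_left_inj' hd] at h
    field_simp at h
    linear_combination h
  rcases mul_eq_zero.1 ((mul_eq_zero.1 h1).resolve_left hs2) with h3 | h3
  · exact Or.inl (sub_eq_zero.1 h3)
  · exact Or.inr (eq_neg_of_add_eq_zero_left h3)

/-- The statement on `C̃` in terms of `s = q^{1/2}` and `x = q^μ`. -/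
theorem IsAWTriple.awCtilde_eq_and_ne {s A1 A2 A3 : ℂ} {I1 I2 I3 : Module.End ℂ V}
    (h : IsAWTriple s A1 A2 A3 I1 I2 I3) (hs : s ≠ 0) (hq : ∀ n : ℕ, 0 < n → (s ^ 2) ^ n ≠ 1)
    (hirr : IsIrreducibleRep I1 I2 I3) {N : ℕ} (hdim : Module.finrank ℂ V = N + 1) {x : ℂ}
    (hx : x ≠ 0) (hx1 : s ^ 2 * x ^ 2 + 1 ≠ 0)
    (hx2 : ∀ m : ℕ, m ≤ 2 * N + 1 → x ^ 2 + (s ^ 2) ^ m ≠ 0)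
    (hspec : ∀ c : ℂ, Module.End.HasEigenvalue I3 c ↔
      ∃ j : Fin (N + 1), c = awEig s (x / (s ^ 2) ^ (j : ℕ))) :
    awCtilde s A1 A2 A3 x = awCtilde s A1 A2 A3 (x / (s ^ 2) ^ (N + 1)) ∧
    ∀ k : ℕ, 1 ≤ k → k ≤ N →
      awCtilde s A1 A2 A3 x ≠ awCtilde s A1 A2 A3 (x / (s ^ 2) ^ k) := by
  have hs4 : s ^ 4 - 1 ≠ 0 := fun h0 => hq 2 (by norm_num) (by linear_combination h0)
  have hs2 : s ^ 2 ≠ 0 := pow_ne_zero 2 hs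
  have hp : ∀ m : ℕ, (s ^ 2) ^ m ≠ 0 := fun m => pow_ne_zero m hs2
  have hpow : ∀ m n : ℕ, (s ^ 2) ^ m = (s ^ 2) ^ n → m = n := by
    have key : ∀ m n : ℕ, m < n → (s ^ 2) ^ m ≠ (s ^ 2) ^ n := fun m n hmn h0 => by
      apply hq (n - m) (by omega)
      rw [← mul_right_inj' (hp m), ← pow_add, mul_one, h0]
      congr 1
      omega
    intro m n hmn
    rcases lt_trichotomy m n with h1 | h1 | h1
    · exact absurd hmn (key m n h1)
    · exact h1
    · exact absurd hmn.symm (key n m h1)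
  set X : ℕ → ℂ := fun j => x / (s ^ 2) ^ j with hX
  have hX0 : ∀ j, X j ≠ 0 := fun j => div_ne_zero hx (hp j)
  have hXdiv : ∀ j, X j / s ^ 2 = X (j + 1) := fun j => by
    simp only [hX]
    rw [div_div, ← pow_succ]
  have hXmul : ∀ j, s ^ 2 * X (j + 1) = X j := fun j => by
    rw [← hXdiv]
    field_simp
  have hXinj : ∀ i j, X i = X j → i = j := fun i j hij => by
    apply hpow i j
    simp only [hX] at hij
    rw [div_eq_div_iff (hp i) (hp j)] at hij
    exact (mul_left_cancel₀ hx hij).symm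
  have hXsq : ∀ j, X j ^ 2 * (s ^ 2) ^ (2 * j) = x ^ 2 := fun j => by
    simp only [hX]
    rw [div_pow, ← pow_mul, mul_comm j 2, div_mul_cancel₀ _ (hp _)]
  have hXX : ∀ i j, X i * X j * (s ^ 2) ^ (i + j) = x ^ 2 := fun i j => by
    have h1 := hp i
    have h2 := hp j
    simp only [hX]
    rw [pow_add]
    field_simp
  have hXX' : ∀ i j, i + j ≤ 2 * N + 1 → X i * X j ≠ -1 := fun i j hij h0 => by
    apply hx2 _ hij
    rw [← hXX i j, h0]
    ring
  have hXone : ∀ j, j ≤ N → X j ^ 2 + 1 ≠ 0 := fun j hj h0 =>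
    hXX' j j (by omega) (by linear_combination h0)
  have hXlow : ∀ j, j ≤ N → X j ^ 2 + s ^ 2 ≠ 0 := fun j hj h0 => by
    apply hXX' j (j + 1) (by omega)
    rw [← hXdiv]
    field_simp
    linear_combination h0
  have hXraise : ∀ j, j ≤ N → s ^ 2 * X j ^ 2 + 1 ≠ 0 := fun j hj h0 => by
    cases j with
    | zero =>
      apply hx1
      simpa [hX] using h0
    | succ i =>
      apply hXX' i (i + 1) (by omega)
      rw [← hXmul i]
      linear_combination h0
  have heig : ∀ i j, i + j ≤ 2 * N + 1 → awEig s (X i) = awEig s (X j) → i = j :=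
    fun i j hij h0 => by
      rcases eq_or_mul_eq_neg_one_of_awEig_eq hs hs4 (hX0 i) (hX0 j) h0 with h1 | h1
      · exact hXinj i j h1
      · exact absurd h1 (hXX' i j hij)
  have he : Function.Injective fun j : Fin (N + 1) => awEig s (X j) := fun i j hij =>
    Fin.ext (heig i j (by omega) hij)
  have hev : ∀ j : Fin (N + 1), ∃ v, Module.End.HasEigenvector I3 (awEig s (X j)) v := fun j =>
    ((hspec _).2 ⟨j, rfl⟩).exists_hasEigenvector
  choose v hv using hev
  have hI3 : ∀ j, I3 (v j) = awEig s (X j) • v j := fun j => (hv j).apply_eq_smul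
  have hlin : LinearIndependent ℂ v := Module.End.eigenvectors_linearIndependent' I3 _ he v hv
  have : FiniteDimensional ℂ V := Module.finite_of_finrank_pos (by omega)
  have : Nontrivial V := Module.nontrivial_of_finrank_pos (R := ℂ) (by omega)
  have hspan : ⊤ ≤ Submodule.span ℂ (Set.range v) :=
    (hlin.span_eq_top_of_card_eq_finrank' (by simp [hdim])).ge
  have hzero : ∀ (c : ℂ) (w : V), (¬ ∃ j : Fin (N + 1), c = awEig s (X j)) → I3 w = c • w →
      w = 0 := fun c w hc hw => by
    by_contra h0
    exact hc ((hspec c).1 (Module.End.hasEigenvalue_of_hasEigenvector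
      ⟨Module.End.mem_eigenspace_iff.2 hw, h0⟩))
  have hR := fun j : Fin (N + 1) => h.three_lower hs hs4 (hX0 j) (hXlow j (by omega)) (hI3 j)
  have hO := fun j : Fin (N + 1) => h.three_shift hs hs4 (hX0 j) (hXraise j (by omega)) (hI3 j)
  have hOzero : ∀ j : Fin (N + 1), (j : ℕ) = 0 → awShift s A1 A2 (X j) I1 I2 (v j) = 0 := by
    intro j hj
    refine hzero _ _ ?_ (hO j)
    rintro ⟨i, hi⟩
    rw [hj] at hi
    rcases eq_or_mul_eq_neg_one_of_awEig_eq hs hs4 (mul_ne_zero hs2 (hX0 0)) (hX0 i) hi with h1 | h1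
    · have h2 : (0 : ℕ) = i + 1 := hXinj _ _ (by rw [← hXdiv, ← h1]; field_simp)
      omega
    · obtain ⟨i, hi'⟩ := i
      cases i with
      | zero => exact hXraise 0 (by omega) (by linear_combination h1)
      | succ i =>
        apply hXX' 0 i (by omega)
        rw [← hXmul i]
        linear_combination h1
  have hRzero : ∀ j : Fin (N + 1), (j : ℕ) = N → awShift s A1 A2 (-(X j)⁻¹) I1 I2 (v j) = 0 := by
    intro j hj
    refine hzero _ _ ?_ (hR j)
    rintro ⟨i, hi⟩
    rw [hXdiv] at hi
    have := heig _ _ (by omega) hi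
    omega
  have hOstep : ∀ i j : Fin (N + 1), (i : ℕ) + 1 = j →
      ∃ c : ℂ, awShift s A1 A2 (X j) I1 I2 (v j) = c • v i := by
    intro i j hij
    refine exists_eq_smul_of_apply_eq_smul he hlin hspan hI3 (i := i) ?_
    rw [← hXmul i, hij]
    exact hO j
  have hRstep : ∀ i j : Fin (N + 1), (i : ℕ) + 1 = j →
      ∃ c : ℂ, awShift s A1 A2 (-(X i)⁻¹) I1 I2 (v i) = c • v j := by
    intro i j hij
    refine exists_eq_smul_of_apply_eq_smul he hlin hspan hI3 (i := j) ?_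
    rw [← hij, ← hXdiv i]
    exact hR i
  obtain ⟨κ, hκ⟩ := h.exists_casimir_eq_smul hs hirr
  have hκ0 : awCtilde s A1 A2 A3 x = κ := by
    have h1 := h.lower_raise hs hs4 (hX0 0) (hXraise 0 (by omega)) (hI3 0) (hκ _)
    have h2 := hOzero 0 rfl
    simp only [Fin.val_zero] at h2
    rw [h2, map_zero, eq_comm, smul_eq_zero_iff_left (hlin.ne_zero 0), sub_eq_zero] at h1
    simpa [hX] using h1
  have hκR : ∀ j : Fin (N + 1), awShift s A1 A2 (X (j + 1)) I1 I2
      (awShift s A1 A2 (-(X j)⁻¹) I1 I2 (v j)) =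
        (awCtilde s A1 A2 A3 (X (j + 1)) - κ) • v j := by
    intro j
    rw [← hXdiv]
    exact h.raise_lower hs hs4 (hX0 j) (hXlow j (by omega)) (hI3 j) (hκ _)
  rw [hκ0]
  refine ⟨?_, fun k hk1 hkN hk => ?_⟩
  · have h1 := hκR (Fin.last N)
    rw [hRzero _ (Fin.val_last N), map_zero, eq_comm,
      smul_eq_zero_iff_left (hlin.ne_zero _), sub_eq_zero, Fin.val_last] at h1
    exact h1.symm
  obtain ⟨i, rfl⟩ : ∃ i, k = i + 1 := ⟨k - 1, by omega⟩
  have hX1 := fun j : Fin (N + 1) => hXone j (by omega)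
  have hmem : ∀ (J : Set (Fin (N + 1))) (c : ℂ), ∀ j ∈ J,
      c • v j ∈ Submodule.span ℂ (v '' J) := fun J c j hj =>
    Submodule.smul_mem _ _ (Submodule.subset_span (Set.mem_image_of_mem v hj))
  obtain ⟨c, hc⟩ := hRstep ⟨i, by omega⟩ ⟨i + 1, by omega⟩ rfl
  by_cases hc0 : c = 0
  · have h1 := eq_univ_of_awShift_mem hs hirr hlin (fun j => hX0 j) hX1 hI3 (A1 := A1) (A2 := A2)
      (J := {j | (j : ℕ) ≤ i}) ⟨0, Nat.zero_le _⟩ (fun j hj => ?_) (fun j hj => ?_)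
    · have h2 : (Fin.last N) ∈ {j : Fin (N + 1) | (j : ℕ) ≤ i} := h1 ▸ Set.mem_univ _
      simp only [Set.mem_ofPred_eq, Fin.val_last] at h2
      omega
    · rw [Set.mem_ofPred_eq] at hj
      by_cases hj0 : (j : ℕ) = 0
      · rw [hOzero j hj0]
        exact Submodule.zero_mem _
      · obtain ⟨d, hd⟩ := hOstep ⟨j - 1, by omega⟩ j (by simp only; omega)
        rw [hd]
        exact hmem _ _ _ (by simp only [Set.mem_ofPred_eq]; omega)
    · rw [Set.mem_ofPred_eq] at hj
      by_cases hji : (j : ℕ) = i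
      · have h2 : j = ⟨i, by omega⟩ := Fin.ext hji
        rw [h2, hc, hc0, zero_smul]
        exact Submodule.zero_mem _
      · obtain ⟨d, hd⟩ := hRstep j ⟨j + 1, by omega⟩ rfl
        rw [hd]
        exact hmem _ _ _ (by simp only [Set.mem_ofPred_eq]; omega)
  · have h0 : awShift s A1 A2 (X (i + 1)) I1 I2 (v ⟨i + 1, by omega⟩) = 0 := by
      have h1 := hκR ⟨i, by omega⟩
      rw [hc, map_smul, ← hk, sub_self, zero_smul] at h1
      exact (smul_eq_zero.1 h1).resolve_left hc0
    have h1 := eq_univ_of_awShift_mem hs hirr hlin (fun j => hX0 j) hX1 hI3 (A1 := A1) (A2 := A2)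
      (J := {j | i + 1 ≤ (j : ℕ)}) ⟨⟨i + 1, by omega⟩, le_refl (i + 1)⟩ (fun j hj => ?_)
      (fun j hj => ?_)
    · have h2 : (0 : Fin (N + 1)) ∈ {j : Fin (N + 1) | i + 1 ≤ (j : ℕ)} := h1 ▸ Set.mem_univ _
      simp only [Set.mem_ofPred_eq, Fin.val_zero] at h2
      omega
    · rw [Set.mem_ofPred_eq] at hj
      by_cases hji : (j : ℕ) = i + 1
      · have h2 : j = ⟨i + 1, by omega⟩ := Fin.ext hji
        rw [h2, h0]
        exact Submodule.zero_mem _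
      · obtain ⟨d, hd⟩ := hOstep ⟨j - 1, by omega⟩ j (by simp only; omega)
        rw [hd]
        exact hmem _ _ _ (by simp only [Set.mem_ofPred_eq]; omega)
    · rw [Set.mem_ofPred_eq] at hj
      by_cases hjN : (j : ℕ) = N
      · rw [hRzero j hjN]
        exact Submodule.zero_mem _
      · obtain ⟨d, hd⟩ := hRstep j ⟨j + 1, by omega⟩ rfl
        rw [hd]
        exact hmem _ _ _ (by simp only [Set.mem_ofPred_eq]; omega)

theorem qp_ne_zero (L lam : ℂ) : qp L lam ≠ 0 := Complex.exp_ne_zero _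

theorem qp_add (L a b : ℂ) : qp L (a + b) = qp L a * qp L b := by
  rw [qp, qp, qp, add_mul, Complex.exp_add]

theorem qp_neg (L a : ℂ) : qp L (-a) = (qp L a)⁻¹ := by
  rw [qp, qp, neg_mul, Complex.exp_neg]

theorem exp_eq_qp_half_sq (L : ℂ) : Complex.exp L = qp L (1 / 2) ^ 2 := by
  rw [qp, ← Complex.exp_nat_mul]
  congr 1
  push_cast
  ring

theorem qp_natCast (L : ℂ) (n : ℕ) : qp L n = (qp L (1 / 2) ^ 2) ^ n := by
  rw [qp, Complex.exp_nat_mul, exp_eq_qp_half_sq]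

theorem qp_sub_natCast (L lam : ℂ) (n : ℕ) :
    qp L (lam - n) = qp L lam / (qp L (1 / 2) ^ 2) ^ n := by
  rw [sub_eq_add_neg, qp_add, qp_neg, qp_natCast]
  exact (div_eq_mul_inv _ _).symm

theorem qp_add_one (L lam : ℂ) : qp L (lam + 1) = qp L (1 / 2) ^ 2 * qp L lam := by
  rw [qp_add, ← exp_eq_qp_half_sq, mul_comm, qp, one_mul]

theorem qn_eq_awNum (L lam : ℂ) : qn L lam = awNum (qp L (1 / 2)) (qp L lam) := by
  rw [qn, awNum, qp_neg, exp_eq_qp_half_sq]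

theorem Ctilde_eq_awCtilde (L A1 A2 A3 lam : ℂ) :
    Ctilde L A1 A2 A3 lam = awCtilde (qp L (1 / 2)) A1 A2 A3 (qp L lam) := by
  have h : qp L (-lam - 1 / 2) = (qp L (1 / 2))⁻¹ * (qp L lam)⁻¹ := by
    rw [sub_eq_add_neg, qp_add, qp_neg, qp_neg, mul_comm]
  rw [Ctilde, awCtilde, qn_eq_awNum, qn_eq_awNum, qp_add_one, exp_eq_qp_half_sq, h, qp_add]
  ring

/-- The parameter of an eigenvalue avoiding `±2/(q−q⁻¹)` and `±1/(q^{1/2}−q^{−1/2})`. -/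
theorem IsClassicalRep.sq_ne {L : ℂ} {I3 : Module.End ℂ V} (hclass : IsClassicalRep L I3)
    {s x : ℂ} (hs : s = qp L (1 / 2)) (hs4 : s ^ 4 - 1 ≠ 0) (hx : x ≠ 0)
    (h : Module.End.HasEigenvalue I3 (awEig s x)) :
    x ^ 2 + 1 ≠ 0 ∧ x ^ 2 + s ^ 2 ≠ 0 ∧ s ^ 2 * x ^ 2 + 1 ≠ 0 := by
  have hI := Complex.I_sq
  have hs0 : s ≠ 0 := hs ▸ qp_ne_zero _ _
  have hd := sq_sub_inv_sq_ne_zero hs0 hs4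
  have hd1 : s - s⁻¹ ≠ 0 := by
    intro hd
    apply hs4
    field_simp at hd
    linear_combination (s ^ 2 + 1) * hd
  have hsq : ∀ ε : ℂ, ε ^ 2 = 1 → ε = 1 ∨ ε = -1 := fun ε h =>
    mul_self_eq_one_iff.1 (by rw [← sq, h])
  simp only [IsClassicalRep, exp_eq_qp_half_sq, qp_neg, ← hs] at hclass
  refine ⟨fun h0 => ?_, fun h0 => ?_, fun h0 => ?_⟩
  · refine (hclass (-Complex.I * x) (hsq _ ?_)).1 ?_
    · linear_combination x ^ 2 * hI - h0
    · convert h using 1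
      rw [awEig, awNum]
      field_simp
      linear_combination -h0
  · refine (hclass (-Complex.I * (x / s)) (hsq _ ?_)).2 ?_
    · field_simp
      linear_combination x ^ 2 * hI - h0
    · convert h using 1
      rw [awEig, awNum, div_eq_iff hd1]
      field_simp
      linear_combination (1 - s ^ 2) * h0
  · refine (hclass (-Complex.I * (x * s)) (hsq _ ?_)).2 ?_
    · linear_combination s ^ 2 * x ^ 2 * hI - h0
    · convert h using 1
      rw [awEig, awNum, div_eq_iff hd1]
      field_simp
      linear_combination (1 - s ^ 2) * h0

/-- for a classical irreducible `(N+1)`-dimensional representation with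
spectrum `−i[μ]_q, …, −i[μ−N]_q` of `I3` and `O_μ` killing a `−i[μ]_q`-eigenvector,
one has `D̃_{N+1} = 0`, `Λ_{N+1} ≠ Λ_0`, and `D̃_k ≠ 0` for `1 ≤ k ≤ N`. -/
theorem char_poly_roots (L : ℂ) (hq : ∀ n : ℕ, 0 < n → Complex.exp L ^ n ≠ 1)
    (A1 A2 A3 : ℂ) {V : Type*} [AddCommGroup V] [Module ℂ V] (N : ℕ)
    (I1 I2 I3 : Module.End ℂ V)
    (hrep : IsAWRep L A1 A2 A3 I1 I2 I3)
    (hirr : IsIrreducibleRep I1 I2 I3)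
    (hclass : IsClassicalRep L I3)
    (hdim : Module.finrank ℂ V = N + 1)
    (μ : ℂ)
    (hspec : ∀ c : ℂ, Module.End.HasEigenvalue I3 c ↔
      ∃ j : Fin (N + 1), c = -Complex.I * qn L (μ - (j : ℕ)))
    (hO : ∃ v0 : V, v0 ≠ 0 ∧ I3 v0 = (-Complex.I * qn L μ) • v0 ∧
      Oop L A1 A2 μ I1 I2 I3 v0 = 0) :
    Dtilde L A1 A2 A3 μ ((N : ℂ) + 1) = 0 ∧
    LamF L μ ((N : ℂ) + 1) ≠ LamF L μ 0 ∧
    (∀ k : ℕ, 1 ≤ k → k ≤ N → Dtilde L A1 A2 A3 μ (k : ℂ) ≠ 0) := by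
  set s := qp L (1 / 2) with hs
  have hs0 : s ≠ 0 := qp_ne_zero _ _
  have hqs : ∀ n : ℕ, 0 < n → (s ^ 2) ^ n ≠ 1 := fun n hn => by
    rw [hs, ← exp_eq_qp_half_sq]
    exact hq n hn
  have hs4 : s ^ 4 - 1 ≠ 0 := fun h0 => hqs 2 (by norm_num) (by linear_combination h0)
  have hp : ∀ m : ℕ, (s ^ 2) ^ m ≠ 0 := fun m => pow_ne_zero m (pow_ne_zero 2 hs0)
  have htriple : IsAWTriple s A1 A2 A3 I1 I2 I3 := by
    simpa only [IsAWRep, IsAWTriple, qp_neg] using hrep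
  have hx : qp L μ ≠ 0 := qp_ne_zero _ _
  have hspec' : ∀ c : ℂ, Module.End.HasEigenvalue I3 c ↔
      ∃ j : Fin (N + 1), c = awEig s (qp L μ / (s ^ 2) ^ (j : ℕ)) := fun c => by
    simp only [hspec, awEig, qn_eq_awNum, qp_sub_natCast, ← hs]
  have hcl : ∀ j : ℕ, j ≤ N → _ := fun j hj =>
    hclass.sq_ne hs hs4 (div_ne_zero hx (hp j)) ((hspec' _).2 ⟨⟨j, by omega⟩, rfl⟩)
  have hx1 : s ^ 2 * qp L μ ^ 2 + 1 ≠ 0 := by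
    simpa using (hcl 0 (Nat.zero_le _)).2.2
  have hx2 : ∀ m : ℕ, m ≤ 2 * N + 1 → qp L μ ^ 2 + (s ^ 2) ^ m ≠ 0 := fun m hm h0 => by
    obtain ⟨j, rfl | rfl⟩ := m.even_or_odd'
    · apply (hcl j (by omega)).1
      rw [div_pow, ← pow_mul, mul_comm j 2, div_add_one (hp _), h0, zero_div]
    · apply (hcl j (by omega)).2.1
      rw [div_pow, ← pow_mul, mul_comm j 2, div_add' _ _ _ (hp _), ← pow_succ', h0, zero_div]
  obtain ⟨h1, h2⟩ := htriple.awCtilde_eq_and_ne hs0 hqs hirr hdim hx hx1 hx2 hspec'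
  refine ⟨?_, fun h0 => ?_, fun k hk1 hkN h0 => h2 k hk1 hkN ?_⟩
  · have h3 : (N : ℂ) + 1 = ((N + 1 : ℕ) : ℂ) := by push_cast; rfl
    rw [Dtilde, h3, Ctilde_eq_awCtilde, Ctilde_eq_awCtilde, qp_sub_natCast, ← hs, h1, sub_self]
  · have h3 : (N : ℂ) + 1 = ((N + 1 : ℕ) : ℂ) := by push_cast; rfl
    rw [LamF, LamF, h3, sub_zero] at h0
    simp only [qn_eq_awNum, qp_add_one, qp_sub_natCast, ← hs] at h0
    rcases eq_or_mul_eq_neg_one_of_awNum_add_eq hs0 hs4 (div_ne_zero hx (hp _)) hx h0 with h4 | h4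
    · apply hqs (N + 1) (by omega)
      rw [div_eq_iff (hp _)] at h4
      exact mul_left_cancel₀ hx (by rw [mul_one]; exact h4.symm)
    · apply hx2 N (by omega)
      field_simp at h4
      refine mul_left_cancel₀ (pow_ne_zero 2 hs0) ?_
      linear_combination h4
  · rwa [Dtilde, Ctilde_eq_awCtilde, Ctilde_eq_awCtilde, qp_sub_natCast, sub_eq_zero] at h0
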